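/- Let λ_1, λ_2, θ be real numbers and set H = (λ_1 + λ_2)/2. Consider the symmetric 3×3 real matrix h = [[0, 0, 0], [0, λ_1 cos 2θ, H sin 2θ], [0, H sin 2θ, −λ_2 cos 2θ]]. Then the characteristic polynomial of h factors as det(X·I − h) = X · (X − λ_+) · (X − λ_−), where λ_+ = λ_1 cos²θ + λ_2 sin²θ and λ_− = −(λ_1 sin²θ + λ_2 cos²θ). In particular, the eigenvalues of h are 0, λ_+ and λ_−. -/

import Mathlib

open Real Polynomial Matrix

/-- The characteristic polynomial of the block sum of a zero `1 × 1` block and a `2 × 2` block, in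
terms of the trace and the determinant of the latter. -/
theorem charpoly_zero_directSum_fin_two {R : Type*} [CommRing R] (a b c d : R) :
    (!![0, 0, 0; 0, a, b; 0, c, d] : Matrix (Fin 3) (Fin 3) R).charpoly =
      X * (X ^ 2 - C (a + d) * X + C (a * d - b * c)) := by
  simp only [Matrix.charpoly, Matrix.det_fin_three, Matrix.charmatrix_apply]
  simp
  ring

/-- **Characteristic polynomial of the second fundamental form.**
For real numbers `λ₁, λ₂, θ` and `H = (λ₁ + λ₂)/2`, the symmetric matrix
`h = [[0,0,0],[0, λ₁ cos 2θ, H sin 2θ],[0, H sin 2θ, -λ₂ cos 2θ]]`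
has characteristic polynomial `X (X - λ₊)(X - λ₋)` where
`λ₊ = λ₁ cos²θ + λ₂ sin²θ` and `λ₋ = -(λ₁ sin²θ + λ₂ cos²θ)`;
in particular its eigenvalues (spectrum) are `{0, λ₊, λ₋}`. -/
theorem tangent_hopf_stmt3 (lam₁ lam₂ θ : ℝ) (H : ℝ) (hH : H = (lam₁ + lam₂) / 2)
    (h : Matrix (Fin 3) (Fin 3) ℝ)
    (hh : h = !![0, 0, 0;
                 0, lam₁ * Real.cos (2 * θ), H * Real.sin (2 * θ);
                 0, H * Real.sin (2 * θ), -lam₂ * Real.cos (2 * θ)])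
    (lamP lamM : ℝ)
    (hP : lamP = lam₁ * Real.cos θ ^ 2 + lam₂ * Real.sin θ ^ 2)
    (hM : lamM = -(lam₁ * Real.sin θ ^ 2 + lam₂ * Real.cos θ ^ 2)) :
    h.charpoly = X * (X - C lamP) * (X - C lamM) ∧
    spectrum ℝ h = {0, lamP, lamM} := by
  have htr : lam₁ * Real.cos (2 * θ) + -lam₂ * Real.cos (2 * θ) = lamP + lamM := by
    rw [hP, hM, Real.cos_two_mul']
    ring
  have hdet : lam₁ * Real.cos (2 * θ) * (-lam₂ * Real.cos (2 * θ))
      - H * Real.sin (2 * θ) * (H * Real.sin (2 * θ)) = lamP * lamM := by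
    rw [hP, hM, hH, Real.cos_two_mul', Real.sin_two_mul]
    ring
  have hchar : h.charpoly = X * (X - C lamP) * (X - C lamM) := by
    rw [hh, charpoly_zero_directSum_fin_two, htr, hdet]
    simp only [C_add, C_mul]
    ring
  refine ⟨hchar, ?_⟩
  ext x
  rw [Matrix.mem_spectrum_iff_isRoot_charpoly, hchar]
  simp [sub_eq_zero, or_assoc]
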